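/- Let ξ : ℝ → (0,∞) be C¹ and let Ψ be C² on the closure of D_ξ with Ψ_Y > 0 there, Ψ(X, 0) = 0 and Ψ(X, ξ(X)) = 1 for all X. Then: (1) for every (q, p) ∈ ℝ × [0,1] there is a unique h(q,p) ∈ [0, ξ(q)] with Ψ(q, h(q,p)) = p; (2) h is C¹ on ℝ × [0,1] and C² on ℝ × (0,1), with h_p(q,p) = 1/Ψ_Y(q, h(q,p)) > 0 and h_q(q,p) = −Ψ_X(q, h(q,p))/Ψ_Y(q, h(q,p)), i.e. Ψ_X = −h_q/h_p and Ψ_Y = 1/h_p at corresponding points; (3) if in addition ΔΨ + ω(Ψ) = 0 in D_ξ and (1/2)|∇Ψ|² + ξ(X) = R on Y = ξ(X), then h satisfies ∂_p( (1 + h_q²)/(2 h_p²) + Ω(p) ) − ∂_q( h_q/h_p ) = 0 in ℝ × (0,1), (1 + h_q²)/(2 h_p²) + h = R at p = 1, and h = 0 at p = 0. -/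

import Mathlib

/-- `Omg ω τ = ∫₀^τ ω(s) ds`. -/
noncomputable def Omg (ω : ℝ → ℝ) (τ : ℝ) : ℝ := ∫ s in (0:ℝ)..τ, ω s

/-- `theta0 ω = √(2 · max_{τ∈[0,1]} Ω(τ))`. -/
noncomputable def theta0 (ω : ℝ → ℝ) : ℝ := Real.sqrt (2 * sSup (Omg ω '' Set.Icc 0 1))

/-- `Rcal ω θ = θ²/2 + ∫₀¹ (θ² − 2Ω(τ))^{−1/2} dτ − Ω(1)`. -/
noncomputable def Rcal (ω : ℝ → ℝ) (θ : ℝ) : ℝ :=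
  θ ^ 2 / 2 + (∫ τ in (0:ℝ)..1, 1 / Real.sqrt (θ ^ 2 - 2 * Omg ω τ)) - Omg ω 1

/-- The critical Bernoulli constant `R_c = inf_{θ>θ₀} ℛ(θ)`. -/
noncomputable def Rc (ω : ℝ → ℝ) : ℝ := sInf (Rcal ω '' Set.Ioi (theta0 ω))

/-- The fluid domain `D_ξ = {(X,Y) : 0 < Y < ξ(X)}`. -/
def fluidDomain (ξ : ℝ → ℝ) : Set (ℝ × ℝ) := {z : ℝ × ℝ | 0 < z.2 ∧ z.2 < ξ z.1}

/-- `Ψ_X`, computed within the closed fluid domain. -/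
noncomputable def psiX (ξ : ℝ → ℝ) (Ψ : ℝ × ℝ → ℝ) (z : ℝ × ℝ) : ℝ :=
  fderivWithin ℝ Ψ (closure (fluidDomain ξ)) z (1, 0)

/-- `Ψ_Y`, computed within the closed fluid domain. -/
noncomputable def psiY (ξ : ℝ → ℝ) (Ψ : ℝ × ℝ → ℝ) (z : ℝ × ℝ) : ℝ :=
  fderivWithin ℝ Ψ (closure (fluidDomain ξ)) z (0, 1)

/-- The water-wave problem (unit flux, unit gravity): `ξ : ℝ → (0,∞)` is `C¹`, `ω` is `C¹` on
`[0,1]`, `Ψ` is `C¹` on the closure of `D_ξ` and `C²` in `D_ξ`, `ΔΨ + ω(Ψ) = 0` in `D_ξ`,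
`(1/2)|∇Ψ|² + ξ = R` on the free surface, `Ψ = 1` on the free surface and `Ψ = 0` on the bottom. -/
def IsWaterWave (ω : ℝ → ℝ) (Ψ : ℝ × ℝ → ℝ) (ξ : ℝ → ℝ) (R : ℝ) : Prop :=
  (∀ X : ℝ, 0 < ξ X) ∧ ContDiff ℝ 1 ξ ∧ ContDiffOn ℝ 1 ω (Set.Icc 0 1) ∧
  ContDiffOn ℝ 1 Ψ (closure (fluidDomain ξ)) ∧ ContDiffOn ℝ 2 Ψ (fluidDomain ξ) ∧
  (∀ z ∈ fluidDomain ξ,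
    fderiv ℝ (psiX ξ Ψ) z (1, 0) + fderiv ℝ (psiY ξ Ψ) z (0, 1) + ω (Ψ z) = 0) ∧
  (∀ X : ℝ, (1/2) * ((psiX ξ Ψ (X, ξ X)) ^ 2 + (psiY ξ Ψ (X, ξ X)) ^ 2) + ξ X = R) ∧
  (∀ X : ℝ, Ψ (X, ξ X) = 1) ∧
  (∀ X : ℝ, Ψ (X, 0) = 0)

/-- `h_q`, computed within `ℝ × [0,1]`. -/
noncomputable def hq (h : ℝ × ℝ → ℝ) (z : ℝ × ℝ) : ℝ :=
  fderivWithin ℝ h (Set.univ ×ˢ Set.Icc 0 1) z (1, 0)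

/-- `h_p`, computed within `ℝ × [0,1]`. -/
noncomputable def hp (h : ℝ × ℝ → ℝ) (z : ℝ × ℝ) : ℝ :=
  fderivWithin ℝ h (Set.univ ×ˢ Set.Icc 0 1) z (0, 1)

open Set Filter Topology

/-- The map `(X, t) ↦ (X, t ξ(X))`, which straightens the fluid domain. -/
def straighten (ξ : ℝ → ℝ) (z : ℝ × ℝ) : ℝ × ℝ := (z.1, z.2 * ξ z.1)

lemma isOpen_fluidDomain {ξ : ℝ → ℝ} (hξ : Continuous ξ) : IsOpen (fluidDomain ξ) :=
  (isOpen_lt continuous_const continuous_snd).inter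
    (isOpen_lt continuous_snd (hξ.comp continuous_fst))

lemma straighten_image_strip {ξ : ℝ → ℝ} (hpos : ∀ X, 0 < ξ X) :
    straighten ξ '' (univ ×ˢ Icc 0 1) = {z : ℝ × ℝ | 0 ≤ z.2 ∧ z.2 ≤ ξ z.1} := by
  ext ⟨x, y⟩
  constructor
  · rintro ⟨⟨q, t⟩, ⟨-, ht⟩, hz⟩
    simp only [straighten, Prod.mk.injEq] at hz
    obtain ⟨rfl, rfl⟩ := hz
    exact ⟨mul_nonneg ht.1 (hpos q).le, mul_le_of_le_one_left (hpos q).le ht.2⟩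
  · rintro ⟨h0, h1⟩
    refine ⟨(x, y / ξ x), ⟨mem_univ _, div_nonneg h0 (hpos x).le, ?_⟩, ?_⟩
    · exact (div_le_one (hpos x)).2 h1
    · simp [straighten, (hpos x).ne']

lemma closure_fluidDomain {ξ : ℝ → ℝ} (hpos : ∀ X, 0 < ξ X) (hξ : Continuous ξ) :
    closure (fluidDomain ξ) = {z : ℝ × ℝ | 0 ≤ z.2 ∧ z.2 ≤ ξ z.1} := by
  apply Subset.antisymm
  · apply closure_minimal
    · exact fun z hz => ⟨hz.1.le, hz.2.le⟩
    · exact (isClosed_le continuous_const continuous_snd).inter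
        (isClosed_le continuous_snd (hξ.comp continuous_fst))
  · have hcont : Continuous (straighten ξ) := by unfold straighten; fun_prop
    have hcl : closure ((univ : Set ℝ) ×ˢ Ioo (0:ℝ) 1) = univ ×ˢ Icc 0 1 := by
      rw [closure_prod_eq, closure_univ, closure_Ioo zero_ne_one]
    rw [← straighten_image_strip hpos, ← hcl]
    refine (image_closure_subset_closure_image hcont).trans (closure_mono ?_)
    rintro _ ⟨⟨q, t⟩, ⟨-, ht⟩, rfl⟩
    exact ⟨mul_pos ht.1 (hpos q), mul_lt_of_lt_one_left (hpos q) ht.2⟩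

lemma uniqueDiffOn_strip : UniqueDiffOn ℝ ((univ : Set ℝ) ×ˢ Icc (0:ℝ) 1) :=
  uniqueDiffOn_univ.prod (uniqueDiffOn_Icc zero_lt_one)

lemma uniqueDiffOn_closure_fluidDomain {ξ : ℝ → ℝ} (hpos : ∀ X, 0 < ξ X)
    (hξ : ContDiff ℝ 1 ξ) : UniqueDiffOn ℝ (closure (fluidDomain ξ)) := by
  rw [closure_fluidDomain hpos hξ.continuous, ← straighten_image_strip hpos]
  rintro _ ⟨z, hz, rfl⟩
  have hd : HasFDerivAt ξ (fderiv ℝ ξ z.1) z.1 :=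
    (hξ.differentiable one_ne_zero z.1).hasFDerivAt
  have hder := hasFDerivAt_fst (𝕜 := ℝ) (p := z) |>.prodMk
    ((hasFDerivAt_snd (𝕜 := ℝ) (p := z)).mul (hd.comp z hasFDerivAt_fst))
  refine HasFDerivWithinAt.uniqueDiffWithinAt (f := straighten ξ) hder.hasFDerivWithinAt
    (uniqueDiffOn_strip z hz) (Function.Surjective.denseRange ?_)
  rintro ⟨a, b⟩
  refine ⟨(a, (b - z.2 * fderiv ℝ ξ z.1 a) / ξ z.1), ?_⟩
  have := (hpos z.1).ne'
  ext
  · simp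
  · simp
    field_simp
    ring

lemma fderivWithin_apply_eq (ξ : ℝ → ℝ) (Ψ : ℝ × ℝ → ℝ) (z v : ℝ × ℝ) :
    fderivWithin ℝ Ψ (closure (fluidDomain ξ)) z v = v.1 * psiX ξ Ψ z + v.2 * psiY ξ Ψ z := by
  have : v = v.1 • ((1, 0) : ℝ × ℝ) + v.2 • ((0, 1) : ℝ × ℝ) := by ext <;> simp
  conv_lhs => rw [this]
  rw [map_add, map_smul, map_smul]
  rfl

lemma strictMonoOn_vertical {ξ : ℝ → ℝ} {Ψ : ℝ × ℝ → ℝ} (hpos : ∀ X, 0 < ξ X)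
    (hξ : Continuous ξ) (hΨ : DifferentiableOn ℝ Ψ (closure (fluidDomain ξ)))
    (hΨY : ∀ z ∈ closure (fluidDomain ξ), 0 < psiY ξ Ψ z) (q : ℝ) :
    StrictMonoOn (fun y => Ψ (q, y)) (Icc 0 (ξ q)) := by
  have hmaps : MapsTo (fun y : ℝ => (q, y)) (Icc 0 (ξ q)) (closure (fluidDomain ξ)) := by
    rw [closure_fluidDomain hpos hξ]
    exact fun y hy => hy
  apply strictMonoOn_of_deriv_pos (convex_Icc _ _)
  · exact hΨ.continuousOn.comp (by fun_prop) hmaps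
  · rw [interior_Icc]
    intro y hy
    have hmem := hmaps (Ioo_subset_Icc_self hy)
    have hnhds : closure (fluidDomain ξ) ∈ 𝓝 (q, y) :=
      mem_of_superset ((isOpen_fluidDomain hξ).mem_nhds hy) subset_closure
    have h1 : HasDerivAt (fun y : ℝ => (q, y)) (0, 1) y :=
      (hasDerivAt_const y q).prodMk (hasDerivAt_id y)
    have h2 := ((hΨ _ hmem).hasFDerivWithinAt.hasFDerivAt hnhds).comp_hasDerivAt y h1
    have h3 : deriv (fun y => Ψ (q, y)) y = psiY ξ Ψ (q, y) := h2.deriv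
    rw [h3]
    exact hΨY _ hmem

lemma existsUnique_height {ξ : ℝ → ℝ} {Ψ : ℝ × ℝ → ℝ} (hpos : ∀ X, 0 < ξ X)
    (hξ : Continuous ξ) (hΨ : ContinuousOn Ψ (closure (fluidDomain ξ)))
    (hmono : ∀ q, StrictMonoOn (fun y => Ψ (q, y)) (Icc 0 (ξ q)))
    (hbot : ∀ X : ℝ, Ψ (X, 0) = 0) (htop : ∀ X : ℝ, Ψ (X, ξ X) = 1)
    (q : ℝ) {p : ℝ} (hp : p ∈ Icc (0:ℝ) 1) :
    ∃! y : ℝ, y ∈ Icc 0 (ξ q) ∧ Ψ (q, y) = p := by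
  have hmaps : MapsTo (fun y : ℝ => (q, y)) (Icc 0 (ξ q)) (closure (fluidDomain ξ)) := by
    rw [closure_fluidDomain hpos hξ]
    exact fun y hy => hy
  have hc : ContinuousOn (fun y => Ψ (q, y)) (Icc 0 (ξ q)) := hΨ.comp (by fun_prop) hmaps
  have himg := intermediate_value_Icc (hpos q).le hc
  simp only [hbot, htop] at himg
  obtain ⟨y, hy, hyp⟩ := himg hp
  exact ⟨y, ⟨hy, hyp⟩, fun y' hy' => (hmono q).injOn hy'.1 hy (hy'.2.trans hyp.symm)⟩

/-- The inverse of a continuous family of strictly increasing functions is jointly continuous. -/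
lemma continuousOn_height {ξ : ℝ → ℝ} {Ψ h : ℝ × ℝ → ℝ} (hpos : ∀ X, 0 < ξ X)
    (hξ : Continuous ξ) (hΨ : ContinuousOn Ψ (closure (fluidDomain ξ)))
    (hmono : ∀ q, StrictMonoOn (fun y => Ψ (q, y)) (Icc 0 (ξ q)))
    (hh : ∀ w ∈ (univ : Set ℝ) ×ˢ Icc (0:ℝ) 1, h w ∈ Icc 0 (ξ w.1) ∧ Ψ (w.1, h w) = w.2) :
    ContinuousOn h ((univ : Set ℝ) ×ˢ Icc (0:ℝ) 1) := by
  intro w hw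
  obtain ⟨hmem, heq⟩ := hh w hw
  have hstrip : ∀ᶠ v in 𝓝[(univ : Set ℝ) ×ˢ Icc (0:ℝ) 1] w,
      v ∈ (univ : Set ℝ) ×ˢ Icc (0:ℝ) 1 := self_mem_nhdsWithin
  have hfst : Tendsto (fun v : ℝ × ℝ => v.1) (𝓝[(univ : Set ℝ) ×ˢ Icc (0:ℝ) 1] w) (𝓝 w.1) :=
    continuous_fst.continuousWithinAt
  have hsnd : Tendsto (fun v : ℝ × ℝ => v.2) (𝓝[(univ : Set ℝ) ×ˢ Icc (0:ℝ) 1] w) (𝓝 w.2) :=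
    continuous_snd.continuousWithinAt
  have hξw : Tendsto (fun v : ℝ × ℝ => ξ v.1) (𝓝[(univ : Set ℝ) ×ˢ Icc (0:ℝ) 1] w)
      (𝓝 (ξ w.1)) := (hξ.tendsto _).comp hfst
  have hlevel : ∀ a, 0 ≤ a → a < ξ w.1 →
      (∀ᶠ v in 𝓝[(univ : Set ℝ) ×ˢ Icc (0:ℝ) 1] w, a ∈ Icc 0 (ξ v.1)) ∧
      Tendsto (fun v : ℝ × ℝ => Ψ (v.1, a)) (𝓝[(univ : Set ℝ) ×ˢ Icc (0:ℝ) 1] w)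
        (𝓝 (Ψ (w.1, a))) := by
    intro a ha0 ha1
    have hev : ∀ᶠ v in 𝓝[(univ : Set ℝ) ×ˢ Icc (0:ℝ) 1] w, a ∈ Icc 0 (ξ v.1) :=
      (hξw.eventually_const_lt ha1).mono fun v hv => ⟨ha0, hv.le⟩
    refine ⟨hev, ?_⟩
    have hmemC : (w.1, a) ∈ closure (fluidDomain ξ) := by
      rw [closure_fluidDomain hpos hξ]
      exact ⟨ha0, ha1.le⟩
    refine Tendsto.comp (hΨ _ hmemC) (tendsto_nhdsWithin_iff.2 ⟨?_, ?_⟩)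
    · exact hfst.prodMk_nhds tendsto_const_nhds
    · rw [closure_fluidDomain hpos hξ]
      exact hev
  refine tendsto_order.2 ⟨fun a ha => ?_, fun b hb => ?_⟩
  · rcases lt_or_ge a 0 with ha0 | ha0
    · filter_upwards [hstrip] with v hv using ha0.trans_le (hh v hv).1.1
    · have haξ : a < ξ w.1 := ha.trans_le hmem.2
      obtain ⟨hev, ht⟩ := hlevel a ha0 haξ
      have hlt : Ψ (w.1, a) < w.2 := heq ▸ hmono w.1 ⟨ha0, haξ.le⟩ hmem ha
      filter_upwards [hstrip, hev, ht.eventually_lt hsnd hlt] with v hv hav hval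
      rw [← (hh v hv).2] at hval
      exact ((hmono v.1).lt_iff_lt hav (hh v hv).1).1 hval
  · rcases lt_or_ge (ξ w.1) b with hbξ | hbξ
    · filter_upwards [hstrip, hξw.eventually_lt_const hbξ] with v hv hvb
        using (hh v hv).1.2.trans_lt hvb
    · obtain ⟨c, hc, hcb⟩ := exists_between hb
      have hc0 : 0 ≤ c := hmem.1.trans hc.le
      have hcξ : c < ξ w.1 := hcb.trans_le hbξ
      obtain ⟨hev, ht⟩ := hlevel c hc0 hcξ
      have hlt : w.2 < Ψ (w.1, c) := heq ▸ hmono w.1 hmem ⟨hc0, hcξ.le⟩ hc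
      filter_upwards [hstrip, hev, hsnd.eventually_lt ht hlt] with v hv hcv hval
      rw [← (hh v hv).2] at hval
      exact (((hmono v.1).lt_iff_lt (hh v hv).1 hcv).1 hval).trans hcb

lemma hasFDerivWithinAt_height {ξ : ℝ → ℝ} {Ψ h : ℝ × ℝ → ℝ} (hpos : ∀ X, 0 < ξ X)
    (hξ : Continuous ξ) (hΨ : DifferentiableOn ℝ Ψ (closure (fluidDomain ξ)))
    (hΨY : ∀ z ∈ closure (fluidDomain ξ), 0 < psiY ξ Ψ z)
    (hh : ∀ w ∈ (univ : Set ℝ) ×ˢ Icc (0:ℝ) 1, h w ∈ Icc 0 (ξ w.1) ∧ Ψ (w.1, h w) = w.2)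
    {w : ℝ × ℝ} (hw : w ∈ (univ : Set ℝ) ×ˢ Icc (0:ℝ) 1) :
    HasFDerivWithinAt h
      ((1 / psiY ξ Ψ (w.1, h w)) • (ContinuousLinearMap.snd ℝ ℝ ℝ
        - psiX ξ Ψ (w.1, h w) • ContinuousLinearMap.fst ℝ ℝ ℝ))
      ((univ : Set ℝ) ×ˢ Icc (0:ℝ) 1) w := by
  have hmaps : MapsTo (fun v : ℝ × ℝ => (v.1, h v)) ((univ : Set ℝ) ×ˢ Icc (0:ℝ) 1)
      (closure (fluidDomain ξ)) := by
    rw [closure_fluidDomain hpos hξ]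
    exact fun v hv => (hh v hv).1
  have hcont : ContinuousOn (fun v : ℝ × ℝ => (v.1, h v)) ((univ : Set ℝ) ×ˢ Icc (0:ℝ) 1) :=
    continuousOn_fst.prodMk (continuousOn_height hpos hξ hΨ.continuousOn
      (strictMonoOn_vertical hpos hξ hΨ hΨY) hh)
  have hne := (hΨY _ (hmaps hw)).ne'
  have hder := (hasFDerivWithinAt_fst (𝕜 := ℝ) (p := (w.1, h w))
    (s := closure (fluidDomain ξ))).prodMk (hΨ _ (hmaps hw)).hasFDerivWithinAt
  have hG := hder.of_comp_of_leftInverse (g := fun v : ℝ × ℝ => (v.1, h v))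
    (f'symm := (ContinuousLinearMap.fst ℝ ℝ ℝ).prod ((1 / psiY ξ Ψ (w.1, h w)) •
      (ContinuousLinearMap.snd ℝ ℝ ℝ - psiX ξ Ψ (w.1, h w) • ContinuousLinearMap.fst ℝ ℝ ℝ)))
    ((hcont w hw).tendsto_nhdsWithin hmaps) (hasFDerivWithinAt_id w _)
    (by
      filter_upwards [self_mem_nhdsWithin] with v hv
      exact Prod.ext rfl (hh v hv).2)
    (fun v => by
      ext
      · simp
      · simp [fderivWithin_apply_eq]
        field_simp
        ring) hw
  simpa using hG.snd

lemma hasDerivAt_Omg {ω : ℝ → ℝ} (hω : ContinuousOn ω (Icc 0 1)) {p : ℝ} (hp : p ∈ Ioo (0:ℝ) 1) :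
    HasDerivAt (Omg ω) (ω p) p := by
  have hIoo : ContinuousOn ω (Ioo 0 1) := hω.mono Ioo_subset_Icc_self
  apply intervalIntegral.integral_hasDerivAt_right
  · apply ContinuousOn.intervalIntegrable
    rw [uIcc_of_le hp.1.le]
    exact hω.mono (Icc_subset_Icc_right hp.2.le)
  · exact hIoo.stronglyMeasurableAtFilter isOpen_Ioo p hp
  · exact hIoo.continuousAt (isOpen_Ioo.mem_nhds hp)

/-- The height equation at an interior point, in terms of the partial derivatives `a` and `b` of the
stream function. -/
lemma height_equation_of_hasFDerivAt {a b : ℝ × ℝ → ℝ} {h : ℝ × ℝ → ℝ} {ω : ℝ → ℝ}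
    {u v : ℝ × ℝ → ℝ} {A B : ℝ × ℝ →L[ℝ] ℝ} {z : ℝ × ℝ}
    (hA : HasFDerivAt a A (z.1, h z)) (hB : HasFDerivAt b B (z.1, h z))
    (hb : b (z.1, h z) ≠ 0)
    (hder : HasFDerivAt h ((1 / b (z.1, h z)) • (ContinuousLinearMap.snd ℝ ℝ ℝ
        - a (z.1, h z) • ContinuousLinearMap.fst ℝ ℝ ℝ)) z)
    (hω : HasDerivAt (Omg ω) (ω z.2) z.2)
    (hu : u =ᶠ[𝓝 z] fun w => ((a (w.1, h w)) ^ 2 + (b (w.1, h w)) ^ 2) / 2 + Omg ω w.2)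
    (hv : v =ᶠ[𝓝 z] fun w => -a (w.1, h w))
    (hlap : A (1, 0) + B (0, 1) + ω z.2 = 0) :
    fderiv ℝ u z (0, 1) - fderiv ℝ v z (1, 0) = 0 := by
  have hG := (hasFDerivAt_fst (𝕜 := ℝ) (p := z)).prodMk hder
  have ha' := HasFDerivAt.comp z (g := a) (f := fun w : ℝ × ℝ => (w.1, h w)) hA hG
  have hb' := HasFDerivAt.comp z (g := b) (f := fun w : ℝ × ℝ => (w.1, h w)) hB hG
  have hω' := hω.comp_hasFDerivAt z (hasFDerivAt_snd (𝕜 := ℝ) (p := z))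
  have hu' := (((ha'.pow 2).add (hb'.pow 2)).mul_const (1 / 2)).add hω'
  have hu'' := hu'.congr_of_eventuallyEq (f₁ := u) (hu.trans (Eventually.of_forall fun w => by
    simp [div_eq_mul_inv]))
  have hv'' := ha'.neg.congr_of_eventuallyEq (f₁ := v) hv
  have hsplit : ∀ (L : ℝ × ℝ →L[ℝ] ℝ) (s t : ℝ), L (s, t) = s * L (1, 0) + t * L (0, 1) := by
    intro L s t
    have : (s, t) = s • ((1, 0) : ℝ × ℝ) + t • ((0, 1) : ℝ × ℝ) := by ext <;> simp
    rw [this, map_add, map_smul, map_smul]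
    rfl
  rw [hu''.fderiv, hv''.fderiv]
  simp
  rw [hsplit A 0 _, hsplit B 0 _, hsplit A 1 (-((b (z.1, h z))⁻¹ * a (z.1, h z)))]
  field_simp
  linear_combination b (z.1, h z) * hlap

/-- the partial hodograph transform. If `Ψ` is `C²` on the closed fluid domain with
`Ψ_Y > 0`, `Ψ = 0` on the bottom and `Ψ = 1` on the surface, then (1) for each `(q,p)` there is a
unique `h(q,p) ∈ [0, ξ(q)]` with `Ψ(q, h(q,p)) = p`; (2) `h` is `C¹` on `ℝ × [0,1]`, `C²` on
`ℝ × (0,1)`, with `h_p = 1/Ψ_Y > 0` and `h_q = −Ψ_X/Ψ_Y`; (3) if moreover `ΔΨ + ω(Ψ) = 0` in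
`D_ξ` and the Bernoulli condition holds on the surface, then `h` solves the hodograph system. -/
theorem stmt12 (ω : ℝ → ℝ) (hω : ContDiffOn ℝ 1 ω (Set.Icc 0 1))
    (ξ : ℝ → ℝ) (Ψ : ℝ × ℝ → ℝ) (R : ℝ)
    (hξpos : ∀ X : ℝ, 0 < ξ X) (hξ : ContDiff ℝ 1 ξ)
    (hΨ : ContDiffOn ℝ 2 Ψ (closure (fluidDomain ξ)))
    (hΨY : ∀ z ∈ closure (fluidDomain ξ), 0 < psiY ξ Ψ z)
    (hbot : ∀ X : ℝ, Ψ (X, 0) = 0) (htop : ∀ X : ℝ, Ψ (X, ξ X) = 1) :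
    (∀ q : ℝ, ∀ p ∈ Set.Icc (0:ℝ) 1,
      ∃! y : ℝ, y ∈ Set.Icc 0 (ξ q) ∧ Ψ (q, y) = p) ∧
    ∃ h : ℝ × ℝ → ℝ,
      (∀ q : ℝ, ∀ p ∈ Set.Icc (0:ℝ) 1,
        h (q, p) ∈ Set.Icc 0 (ξ q) ∧ Ψ (q, h (q, p)) = p) ∧
      ContDiffOn ℝ 1 h (Set.univ ×ˢ Set.Icc 0 1) ∧
      ContDiffOn ℝ 2 h (Set.univ ×ˢ Set.Ioo 0 1) ∧
      (∀ z ∈ Set.univ ×ˢ Set.Icc (0:ℝ) 1,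
        hp h z = 1 / psiY ξ Ψ (z.1, h z) ∧ 0 < hp h z ∧
        hq h z = - psiX ξ Ψ (z.1, h z) / psiY ξ Ψ (z.1, h z)) ∧
      ((∀ z ∈ fluidDomain ξ,
          fderiv ℝ (psiX ξ Ψ) z (1, 0) + fderiv ℝ (psiY ξ Ψ) z (0, 1) + ω (Ψ z) = 0) →
       (∀ X : ℝ,
          (1/2) * ((psiX ξ Ψ (X, ξ X)) ^ 2 + (psiY ξ Ψ (X, ξ X)) ^ 2) + ξ X = R) →
        (∀ z ∈ Set.univ ×ˢ Set.Ioo (0:ℝ) 1,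
          fderiv ℝ (fun w => (1 + (hq h w) ^ 2) / (2 * (hp h w) ^ 2) + Omg ω w.2) z (0, 1)
            - fderiv ℝ (fun w => hq h w / hp h w) z (1, 0) = 0) ∧
        (∀ q : ℝ, (1 + (hq h (q, 1)) ^ 2) / (2 * (hp h (q, 1)) ^ 2) + h (q, 1) = R) ∧
        (∀ q : ℝ, h (q, 0) = 0)) := by
  have hξc := hξ.continuous
  have hΨd : DifferentiableOn ℝ Ψ (closure (fluidDomain ξ)) := hΨ.differentiableOn two_ne_zero
  have hmono := strictMonoOn_vertical hξpos hξc hΨd hΨY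
  have hex : ∀ q : ℝ, ∀ p ∈ Icc (0:ℝ) 1, ∃! y : ℝ, y ∈ Icc 0 (ξ q) ∧ Ψ (q, y) = p :=
    fun q p hp => existsUnique_height hξpos hξc hΨ.continuousOn hmono hbot htop q hp
  refine ⟨hex, ?_⟩
  have hex' : ∀ w : ℝ × ℝ, w ∈ (univ : Set ℝ) ×ˢ Icc (0:ℝ) 1 →
      ∃ y : ℝ, y ∈ Icc 0 (ξ w.1) ∧ Ψ (w.1, y) = w.2 :=
    fun w hw => (hex w.1 w.2 hw.2).exists
  choose! h hh using hex'
  have hder := fun w hw => hasFDerivWithinAt_height hξpos hξc hΨd hΨY hh (w := w) hw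
  have hmaps : MapsTo (fun v : ℝ × ℝ => (v.1, h v)) ((univ : Set ℝ) ×ˢ Icc (0:ℝ) 1)
      (closure (fluidDomain ξ)) := by
    rw [closure_fluidDomain hξpos hξc]
    exact fun v hv => (hh v hv).1
  have hne : ∀ w ∈ (univ : Set ℝ) ×ˢ Icc (0:ℝ) 1, psiY ξ Ψ (w.1, h w) ≠ 0 :=
    fun w hw => (hΨY _ (hmaps hw)).ne'
  have hgrad : ContDiffOn ℝ 1 (fderivWithin ℝ Ψ (closure (fluidDomain ξ)))
      (closure (fluidDomain ξ)) :=
    hΨ.fderivWithin (uniqueDiffOn_closure_fluidDomain hξpos hξ) (by norm_num)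
  have hX : ContDiffOn ℝ 1 (psiX ξ Ψ) (closure (fluidDomain ξ)) :=
    hgrad.clm_apply contDiffOn_const
  have hY : ContDiffOn ℝ 1 (psiY ξ Ψ) (closure (fluidDomain ξ)) :=
    hgrad.clm_apply contDiffOn_const
  have hfd : ∀ w ∈ (univ : Set ℝ) ×ˢ Icc (0:ℝ) 1,
      fderivWithin ℝ h ((univ : Set ℝ) ×ˢ Icc (0:ℝ) 1) w =
        (1 / psiY ξ Ψ (w.1, h w)) • (ContinuousLinearMap.snd ℝ ℝ ℝ
          - psiX ξ Ψ (w.1, h w) • ContinuousLinearMap.fst ℝ ℝ ℝ) :=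
    fun w hw => (hder w hw).fderivWithin (uniqueDiffOn_strip w hw)
  have hdiff : DifferentiableOn ℝ h ((univ : Set ℝ) ×ˢ Icc (0:ℝ) 1) :=
    fun w hw => (hder w hw).differentiableWithinAt
  have hstep : ∀ n : ℕ∞, n ≤ 1 → ContDiffOn ℝ n h ((univ : Set ℝ) ×ˢ Icc (0:ℝ) 1) →
      ContDiffOn ℝ (n + 1) h ((univ : Set ℝ) ×ˢ Icc (0:ℝ) 1) := by
    intro n hn hsm
    refine (contDiffOn_succ_iff_fderivWithin uniqueDiffOn_strip).2
      ⟨hdiff, fun hω => absurd hω (by simp), ContDiffOn.congr ?_ hfd⟩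
    have hn' : (n : WithTop ℕ∞) ≤ 1 := by exact_mod_cast hn
    have hG : ContDiffOn ℝ n (fun v : ℝ × ℝ => (v.1, h v)) ((univ : Set ℝ) ×ˢ Icc (0:ℝ) 1) :=
      contDiffOn_fst.prodMk hsm
    have hXG := (hX.of_le hn').comp hG hmaps
    have hYG := (hY.of_le hn').comp hG hmaps
    exact (contDiffOn_const.div hYG hne).smul
      (contDiffOn_const.sub (hXG.smul contDiffOn_const))
  have hC1 : ContDiffOn ℝ 1 h ((univ : Set ℝ) ×ˢ Icc (0:ℝ) 1) := by
    simpa using hstep 0 zero_le_one (contDiffOn_zero.2 hdiff.continuousOn)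
  have hC2 : ContDiffOn ℝ 2 h ((univ : Set ℝ) ×ˢ Icc (0:ℝ) 1) := by
    simpa [one_add_one_eq_two] using hstep 1 le_rfl hC1
  have hpeq : ∀ w ∈ (univ : Set ℝ) ×ˢ Icc (0:ℝ) 1, hp h w = 1 / psiY ξ Ψ (w.1, h w) := by
    intro w hw
    simp [hp, hfd w hw]
  have hqeq : ∀ w ∈ (univ : Set ℝ) ×ˢ Icc (0:ℝ) 1,
      hq h w = - psiX ξ Ψ (w.1, h w) / psiY ξ Ψ (w.1, h w) := by
    intro w hw
    simp [hq, hfd w hw]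
    ring
  have hflux : ∀ w ∈ (univ : Set ℝ) ×ˢ Icc (0:ℝ) 1, (1 + (hq h w) ^ 2) / (2 * (hp h w) ^ 2) =
      ((psiX ξ Ψ (w.1, h w)) ^ 2 + (psiY ξ Ψ (w.1, h w)) ^ 2) / 2 := by
    intro w hw
    have := hne w hw
    rw [hpeq w hw, hqeq w hw]
    field_simp
    ring
  have hslope : ∀ w ∈ (univ : Set ℝ) ×ˢ Icc (0:ℝ) 1,
      hq h w / hp h w = - psiX ξ Ψ (w.1, h w) := by
    intro w hw
    have := hne w hw
    rw [hpeq w hw, hqeq w hw]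
    field_simp
  have hh1 : ∀ q, h (q, 1) = ξ q := by
    intro q
    have hm : (1:ℝ) ∈ Icc (0:ℝ) 1 := right_mem_Icc.2 zero_le_one
    exact (hex q 1 hm).unique (hh (q, 1) ⟨mem_univ _, hm⟩)
      ⟨right_mem_Icc.2 (hξpos q).le, htop q⟩
  have hh0 : ∀ q, h (q, 0) = 0 := by
    intro q
    have hm : (0:ℝ) ∈ Icc (0:ℝ) 1 := left_mem_Icc.2 zero_le_one
    exact (hex q 0 hm).unique (hh (q, 0) ⟨mem_univ _, hm⟩)
      ⟨left_mem_Icc.2 (hξpos q).le, hbot q⟩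
  refine ⟨h, fun q p hp => hh (q, p) ⟨mem_univ _, hp⟩, hC1,
    hC2.mono (prod_mono_right Ioo_subset_Icc_self), fun w hw => ⟨hpeq w hw, ?_, hqeq w hw⟩,
    fun hlap hbern => ⟨fun z hz => ?_, fun q => ?_, hh0⟩⟩
  · rw [hpeq w hw]
    exact one_div_pos.2 (hΨY _ (hmaps hw))
  · have hzs : z ∈ (univ : Set ℝ) ×ˢ Icc (0:ℝ) 1 := prod_mono_right Ioo_subset_Icc_self hz
    have hnhds : (univ : Set ℝ) ×ˢ Icc (0:ℝ) 1 ∈ 𝓝 z :=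
      mem_of_superset ((isOpen_univ.prod isOpen_Ioo).mem_nhds hz)
        (prod_mono_right Ioo_subset_Icc_self)
    obtain ⟨hmem, hval⟩ := hh z hzs
    have hin : (z.1, h z) ∈ fluidDomain ξ := by
      refine ⟨hmem.1.lt_of_ne fun h0 => hz.2.1.ne ?_, hmem.2.lt_of_ne fun h1 => hz.2.2.ne ?_⟩
      · rw [← hval, ← show (0:ℝ) = h z from h0, hbot]
      · rw [← hval, show h z = ξ z.1 from h1, htop]
    have hCn : closure (fluidDomain ξ) ∈ 𝓝 (z.1, h z) :=
      mem_of_superset ((isOpen_fluidDomain hξc).mem_nhds hin) subset_closure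
    refine height_equation_of_hasFDerivAt
      ((hX.contDiffAt hCn).differentiableAt one_ne_zero).hasFDerivAt
      ((hY.contDiffAt hCn).differentiableAt one_ne_zero).hasFDerivAt (hne z hzs)
      ((hder z hzs).hasFDerivAt hnhds) (hasDerivAt_Omg hω.continuousOn hz.2) ?_ ?_ ?_
    · filter_upwards [hnhds] with w hw
      rw [hflux w hw]
    · filter_upwards [hnhds] with w hw using hslope w hw
    · have := hlap _ hin
      rwa [hval] at this
  · rw [hflux (q, 1) ⟨mem_univ _, right_mem_Icc.2 zero_le_one⟩, hh1]
    linear_combination hbern q
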